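/- Let G be a finite group and m = (m_1,…,m_s) a tuple of positive integers. The number of orbits of the right G-action on γ(m,G) equals (1/|G|) · Σ_{t ∣ d} ( ∏_{i=1}^s C(m_i/t + |G|/t − 1, m_i/t) ) · φ_G(t), where d = gcd(m_1,…,m_s,Exp(G)) and C(·,·) denotes the binomial coefficient. -/

import Mathlib

open scoped BigOperators

/-- `γ(m, G)`: the set of functions `a : {1,…,s} × G → ℤ` with `a(i,g) ≥ 0` for all
`(i,g)` and `Σ_{g ∈ G} a(i, g) = m_i` for each `i`. -/
def gammaSet {s : ℕ} (m : Fin s → ℕ) (G : Type*) [Fintype G] : Type _ :=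
  {a : Fin s × G → ℤ // (∀ x, 0 ≤ a x) ∧ ∀ i : Fin s, ∑ g : G, a (i, g) = m i}

/-- The right action of `G` on `γ(m, G)`: `(a · h)(i, g) = a(i, gh)`. -/
def gammaAct {s : ℕ} {m : Fin s → ℕ} {G : Type*} [Group G] [Fintype G]
    (a : gammaSet m G) (h : G) : gammaSet m G :=
  ⟨fun x => a.1 (x.1, x.2 * h),
    ⟨fun x => a.2.1 _, fun i => by
      rw [← a.2.2 i]
      exact Fintype.sum_equiv (Equiv.mulRight h) _ _ (fun g => rfl)⟩⟩

/-- `φ_G(t)`: the number of elements of `G` of order `t`. -/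
noncomputable def orderCount (G : Type*) [Monoid G] (t : ℕ) : ℕ :=
  Nat.card {g : G // orderOf g = t}


instance gammaMulAction {s : ℕ} {m : Fin s → ℕ} {G : Type*} [Group G] [Fintype G] :
    MulAction G (gammaSet m G) where
  smul h a := gammaAct a h
  one_smul a := Subtype.ext (funext fun x => by
    change a.1 (x.1, x.2 * 1) = a.1 x
    rw [mul_one])
  mul_smul g h a := Subtype.ext (funext fun x => by
    change a.1 (x.1, x.2 * (g * h)) = a.1 (x.1, x.2 * g * h)
    rw [mul_assoc])

theorem sum_quot_mk {G : Type*} [Group G] [Fintype G] (h : G)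
    [Fintype (G ⧸ Subgroup.zpowers h)] (f : G ⧸ Subgroup.zpowers h → ℤ) :
    ∑ g : G, f (QuotientGroup.mk g) = orderOf h * ∑ q, f q := by
  classical
  have := Fintype.sum_equiv (Subgroup.groupEquivQuotientProdSubgroup (s := Subgroup.zpowers h))
    (fun g => f (QuotientGroup.mk g)) (fun p => f p.1) (fun g => rfl)
  rw [this, Fintype.sum_prod_type]
  simp [Fintype.card_zpowers, Finset.mul_sum]

theorem fixed_zpow {G : Type*} [Group G] {f : G → ℤ} {h : G} (hf : ∀ g, f (g * h) = f g)
    (a b : G) (hab : (QuotientGroup.leftRel (Subgroup.zpowers h)) a b) : f a = f b := by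
  rw [QuotientGroup.leftRel_apply] at hab
  obtain ⟨k, hk⟩ := hab
  have key : ∀ (k : ℤ) (g : G), f (g * h ^ k) = f g := by
    intro k
    induction k with
    | zero => simp
    | succ n ih => intro g; rw [zpow_add_one, ← mul_assoc, hf, ih]
    | pred n ih =>
      intro g
      rw [← hf, mul_assoc, ← zpow_add_one, sub_add_cancel, ih]
  have : b = a * h ^ k := by
    have : h ^ k = a⁻¹ * b := hk
    rw [this]; group
  rw [this, key]

/-- Points fixed by `h` are families of functions on the coset space of `h`. -/
noncomputable def fixedEquiv {s : ℕ} (m : Fin s → ℕ) {G : Type*} [Group G] [Fintype G] (h : G)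
    [Fintype (G ⧸ Subgroup.zpowers h)] :
    MulAction.fixedBy (gammaSet m G) h ≃
      ((i : Fin s) → {f : G ⧸ Subgroup.zpowers h → ℕ // orderOf h * ∑ q, f q = m i}) where
  toFun a i :=
    have ha : ∀ g, a.1.1 (i, g * h) = a.1.1 (i, g) := fun g =>
      congrFun (congrArg Subtype.val a.2) (i, g)
    ⟨fun q => Quotient.liftOn q (fun g => (a.1.1 (i, g)).toNat) (fun x y hxy => by
      have := fixed_zpow (f := fun g => a.1.1 (i, g)) ha x y hxy
      exact congrArg Int.toNat this), by
      have h1 := a.1.2.2 i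
      zify
      rw [← sum_quot_mk, ← h1]
      refine Finset.sum_congr rfl fun g _ => ?_
      exact Int.toNat_of_nonneg (a.1.2.1 (i, g))⟩
  invFun b := ⟨⟨fun x => ((b x.1).1 (QuotientGroup.mk x.2) : ℤ), fun x => by positivity, fun i => by
      simp only
      rw [sum_quot_mk h (fun q => ((b i).1 q : ℤ))]
      exact_mod_cast (b i).2⟩, by
      refine Subtype.ext (funext fun x => ?_)
      change ((b x.1).1 (QuotientGroup.mk (x.2 * h)) : ℤ) = ((b x.1).1 (QuotientGroup.mk x.2) : ℤ)
      rw [QuotientGroup.mk_mul_of_mem _ (Subgroup.mem_zpowers h)]⟩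
  left_inv a := by
    refine Subtype.ext (Subtype.ext (funext fun x => ?_))
    exact Int.toNat_of_nonneg (a.1.2.1 x)
  right_inv b := by
    refine funext fun i => Subtype.ext (funext fun q => ?_)
    induction q using Quotient.inductionOn with
    | h g => exact Int.toNat_natCast _

theorem card_sum_eq (Q : Type*) [Fintype Q] (t n : ℕ) (ht : 0 < t) :
    Finite {f : Q → ℕ // t * ∑ q, f q = n} ∧
    Nat.card {f : Q → ℕ // t * ∑ q, f q = n} =
      if t ∣ n then (n / t + Fintype.card Q - 1).choose (n / t) else 0 := by
  classical
  split_ifs with hd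
  · obtain ⟨k, rfl⟩ := hd
    have e : {f : Q → ℕ // t * ∑ q, f q = t * k} ≃ Sym Q k :=
      (Equiv.subtypeEquivRight fun f => by
        rw [Nat.mul_right_inj ht.ne']).trans (Sym.equivNatSumOfFintype Q k).symm
    refine ⟨Finite.of_equiv _ e.symm, ?_⟩
    rw [Nat.card_congr e, Nat.card_eq_fintype_card, Sym.card_sym_eq_choose,
      Nat.mul_div_cancel_left _ ht, add_comm]
  · have : IsEmpty {f : Q → ℕ // t * ∑ q, f q = n} :=
      ⟨fun f => hd ⟨_, f.2.symm⟩⟩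
    exact ⟨inferInstance, Nat.card_of_isEmpty⟩

theorem card_fixed {s : ℕ} (m : Fin s → ℕ) {G : Type*} [Group G] [Fintype G] (h : G) :
    Finite (MulAction.fixedBy (gammaSet m G) h) ∧
    Nat.card (MulAction.fixedBy (gammaSet m G) h) =
      if orderOf h ∣ Finset.univ.gcd m then
        ∏ i, (m i / orderOf h + Fintype.card G / orderOf h - 1).choose (m i / orderOf h) else 0 := by
  classical
  have ht := orderOf_pos h
  have : Fintype (G ⧸ Subgroup.zpowers h) := Fintype.ofFinite _
  have hQ : Fintype.card (G ⧸ Subgroup.zpowers h) = Fintype.card G / orderOf h := by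
    rw [← Nat.card_eq_fintype_card, ← Nat.card_eq_fintype_card,
      Subgroup.card_eq_card_quotient_mul_card_subgroup (Subgroup.zpowers h), Nat.card_zpowers,
      Nat.mul_div_cancel _ ht]
  have hc := fun i => card_sum_eq (G ⧸ Subgroup.zpowers h) (orderOf h) (m i) ht
  have := fun i => (hc i).1
  refine ⟨Finite.of_equiv _ (fixedEquiv m h).symm, ?_⟩
  rw [Nat.card_congr (fixedEquiv m h), Nat.card_pi]
  simp only [(hc _).2, hQ]
  split_ifs with hd
  · exact Finset.prod_congr rfl fun i hi => if_pos ((Finset.dvd_gcd_iff.1 hd) i hi)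
  · rw [Finset.dvd_gcd_iff] at hd
    push Not at hd
    obtain ⟨i, hi, hn⟩ := hd
    exact Finset.prod_eq_zero hi (if_neg hn)

/-- **Burnside count.** The number of orbits of the right `G`-action on `γ(m, G)` is
`(1/|G|) · Σ_{t ∣ d} (∏_i C(m_i/t + |G|/t − 1, m_i/t)) · φ_G(t)`, where
`d = gcd(m_1, …, m_s, Exp(G))`. -/
theorem card_orbits_gammaAct (G : Type*) [Group G] [Fintype G]
    (s : ℕ) (m : Fin s → ℕ) (hm : ∀ i, 0 < m i) :
    (Nat.card (Quot (fun a b : gammaSet m G => ∃ h : G, gammaAct a h = b)) : ℚ) =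
      (1 / (Fintype.card G : ℚ)) *
        ∑ t ∈ (Nat.gcd (Finset.univ.gcd m) (Monoid.exponent G)).divisors,
          (∏ i, ((m i / t + Fintype.card G / t - 1).choose (m i / t) : ℚ)) *
            (orderCount G t : ℚ) := by
  classical
  have hfin := fun h : G => (card_fixed m h).1
  have hX : Finite (gammaSet m G) :=
    Finite.of_injective (β := MulAction.fixedBy (gammaSet m G) (1 : G))
      (fun a => ⟨a, one_smul G a⟩) (fun a b hab => congrArg Subtype.val hab)
  have : ∀ h : G, Fintype (MulAction.fixedBy (gammaSet m G) h) := fun h => Fintype.ofFinite _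
  have : Finite (Quotient (MulAction.orbitRel G (gammaSet m G))) := Quotient.finite _
  have : Fintype (Quotient (MulAction.orbitRel G (gammaSet m G))) := Fintype.ofFinite _
  have hB := MulAction.sum_card_fixedBy_eq_card_orbits_mul_card_group G (gammaSet m G)
  have hq : Nat.card (Quot (fun a b : gammaSet m G => ∃ h : G, gammaAct a h = b)) =
      Fintype.card (Quotient (MulAction.orbitRel G (gammaSet m G))) := by
    rw [← Nat.card_eq_fintype_card]
    refine Nat.card_congr (Quot.congrRight fun a b => ?_)
    constructor
    · rintro ⟨h, rfl⟩
      exact (MulAction.orbitRel G (gammaSet m G)).symm ⟨h, rfl⟩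
    · intro hab
      exact (MulAction.orbitRel G (gammaSet m G)).symm hab
  have hG : (Fintype.card G : ℚ) ≠ 0 := by exact_mod_cast Fintype.card_ne_zero
  rw [hq, one_div, eq_inv_mul_iff_mul_eq₀ hG, mul_comm]
  have hB' : (Fintype.card (Quotient (MulAction.orbitRel G (gammaSet m G))) : ℚ) *
      Fintype.card G = ∑ h : G, (Nat.card (MulAction.fixedBy (gammaSet m G) h) : ℚ) := by
    simp only [Nat.card_eq_fintype_card]
    exact_mod_cast hB.symm
  rw [hB']
  have hE : Monoid.exponent G ≠ 0 := Monoid.exponent_ne_zero_of_finite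
  have hoc : ∀ t, orderCount G t = (Finset.univ.filter fun g : G => orderOf g = t).card := by
    intro t
    rw [orderCount, Nat.card_eq_fintype_card, Fintype.card_subtype]
  simp only [(card_fixed m _).2, hoc]
  have hmem : ∀ h : G, orderOf h ∈ (Nat.gcd (Finset.univ.gcd m) (Monoid.exponent G)).divisors ↔
      orderOf h ∣ Finset.univ.gcd m := by
    intro h
    rw [Nat.mem_divisors, Nat.dvd_gcd_iff]
    exact ⟨fun H => H.1.1, fun H => ⟨⟨H, Monoid.order_dvd_exponent h⟩,
      Nat.gcd_ne_zero_right hE⟩⟩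
  push_cast
  rw [← Finset.sum_filter, ← Finset.sum_fiberwise_of_maps_to (g := fun h : G => orderOf h)
    (t := (Nat.gcd (Finset.univ.gcd m) (Monoid.exponent G)).divisors)
    (fun h hh => (hmem h).2 (Finset.mem_filter.1 hh).2)]
  refine Finset.sum_congr rfl fun t ht => ?_
  rw [Finset.filter_filter, mul_comm, ← nsmul_eq_mul, ← Finset.sum_const]
  refine Finset.sum_congr ?_ ?_
  · ext h
    simp only [Finset.mem_filter, Finset.mem_univ, true_and]
    refine ⟨fun H => H.2, fun H => ⟨(hmem h).1 (H ▸ ht), H⟩⟩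
  · intro h hh
    rw [(Finset.mem_filter.1 hh).2]
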